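/- arXiv:1609.07532 — 2 statements merged into one kernel-verified Lean document; each statement's English description precedes it below -/
import Mathlib

section
/- Let X and Y be Banach spaces and μ0 a Borel probability measure on X. Let Φ : X × Y → ℝ be such that Φ(·;y) is Borel measurable for each y and: (i) there is a nondecreasing function f1 : [0,∞) → [1,∞) such that for every r > 0 there is M(r) ∈ ℝ with Φ(u;y) ≥ M(r) − log f1(‖u‖_X) for all u ∈ X and all y ∈ B_Y(r); (ii) for every r > 0 there is K(r) > 0 with Φ(u;y) ≤ K(r) for all u ∈ B_X(r) and y ∈ B_Y(r); (iv) there is a nondecreasing function f2 : [0,∞) → [0,∞) such that for every r > 0 there is C(r) > 0 with |Φ(u;y1) − Φ(u;y2)| ≤ C(r) f2(‖u‖_X) ‖y1 − y2‖_Y for all y1, y2 ∈ B_Y(r) and all u ∈ X. If u ↦ f2(‖u‖_X)² f1(‖u‖_X) is integrable with respect to μ0, then for every r > 0 there exists a constant C'(r) > 0 such that d_H(μ^y, μ^{y'}) ≤ C'(r) ‖y − y'‖_Y for all y, y' ∈ B_Y(r). -/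
open MeasureTheory Real

/-- If `g`, `h` are nonnegative and integrable then `√g * √h` is integrable. -/
lemma integrable_sqrt_mul_sqrt {α : Type*} [MeasurableSpace α] {μ : Measure α} {g h : α → ℝ}
    (hg0 : ∀ x, 0 ≤ g x) (hh0 : ∀ x, 0 ≤ h x) (hg : Integrable g μ) (hh : Integrable h μ) :
    Integrable (fun x => √(g x) * √(h x)) μ := by
  refine (hg.add hh).mono' ?_ (ae_of_all _ fun x => ?_)
  · exact (Real.continuous_sqrt.comp_aestronglyMeasurable hg.aestronglyMeasurable).mul
      (Real.continuous_sqrt.comp_aestronglyMeasurable hh.aestronglyMeasurable)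
  · rw [Real.norm_of_nonneg (by positivity), Pi.add_apply]
    nlinarith [sq_nonneg (√(g x) - √(h x)), Real.sq_sqrt (hg0 x), Real.sq_sqrt (hh0 x),
      hg0 x, hh0 x]

/-- Normalizing two densities increases the squared `L²` distance of their square roots at most
by the factor `1 / (√Z √W)`, where `Z` and `W` are the normalizing constants. -/
lemma integral_sq_sub_sqrt_div_integral_le {α : Type*} [MeasurableSpace α] {μ : Measure α}
    {g h : α → ℝ} (hg0 : ∀ x, 0 ≤ g x) (hh0 : ∀ x, 0 ≤ h x)
    (hg : Integrable g μ) (hh : Integrable h μ)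
    (hgpos : 0 < ∫ x, g x ∂μ) (hhpos : 0 < ∫ x, h x ∂μ) :
    ∫ x, (√(g x / ∫ v, g v ∂μ) - √(h x / ∫ v, h v ∂μ)) ^ 2 ∂μ ≤
      (∫ x, (√(g x) - √(h x)) ^ 2 ∂μ) / (√(∫ v, g v ∂μ) * √(∫ v, h v ∂μ)) := by
  have hgh := integrable_sqrt_mul_sqrt hg0 hh0 hg hh
  have expand : ∀ s t : ℝ, ∫ x, (s * g x + t * h x - 2 * (√s * √t) * (√(g x) * √(h x))) ∂μ =
      s * (∫ x, g x ∂μ) + t * (∫ x, h x ∂μ) - 2 * (√s * √t) * ∫ x, √(g x) * √(h x) ∂μ := by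
    intro s t
    have hadd : Integrable (fun x => s * g x + t * h x) μ := (hg.const_mul s).add (hh.const_mul t)
    rw [integral_sub hadd (hgh.const_mul _),
      integral_add (hg.const_mul s) (hh.const_mul t), integral_const_mul, integral_const_mul,
      integral_const_mul]
  have sq_expand : ∀ s t : ℝ, 0 ≤ s → 0 ≤ t → ∀ x, (√(s * g x) - √(t * h x)) ^ 2 =
      s * g x + t * h x - 2 * (√s * √t) * (√(g x) * √(h x)) := by
    intro s t hs ht x
    rw [sub_sq, Real.sq_sqrt (mul_nonneg hs (hg0 x)), Real.sq_sqrt (mul_nonneg ht (hh0 x)),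
      Real.sqrt_mul hs, Real.sqrt_mul ht]
    ring
  set Z := ∫ v, g v ∂μ
  set W := ∫ v, h v ∂μ
  have left : ∫ x, (√(g x / Z) - √(h x / W)) ^ 2 ∂μ =
      2 - 2 * (√Z⁻¹ * √W⁻¹) * ∫ x, √(g x) * √(h x) ∂μ := by
    simp_rw [div_eq_inv_mul, sq_expand Z⁻¹ W⁻¹ (by positivity) (by positivity), expand,
      inv_mul_cancel₀ hgpos.ne', inv_mul_cancel₀ hhpos.ne']
    ring
  have right : ∫ x, (√(g x) - √(h x)) ^ 2 ∂μ = Z + W - 2 * ∫ x, √(g x) * √(h x) ∂μ := by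
    have := expand 1 1
    simp_rw [← sq_expand 1 1 zero_le_one zero_le_one] at this
    simpa using this
  have hZ : 0 < √Z := Real.sqrt_pos.2 hgpos
  have hW : 0 < √W := Real.sqrt_pos.2 hhpos
  rw [left, right, le_div_iff₀ (by positivity), Real.sqrt_inv, Real.sqrt_inv]
  have : (2 - 2 * ((√Z)⁻¹ * (√W)⁻¹) * ∫ x, √(g x) * √(h x) ∂μ) * (√Z * √W) =
      2 * (√Z * √W) - 2 * ∫ x, √(g x) * √(h x) ∂μ := by
    field_simp
  rw [this]
  nlinarith [sq_nonneg (√Z - √W), Real.sq_sqrt hgpos.le, Real.sq_sqrt hhpos.le]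

lemma sq_sub_sqrt_exp_neg_le {s t E : ℝ} (hs : exp (-s) ≤ E) (ht : exp (-t) ≤ E) :
    (√(exp (-s)) - √(exp (-t))) ^ 2 ≤ E * (s - t) ^ 2 / 4 := by
  wlog hst : s ≤ t generalizing s t
  · have := this ht hs (le_of_not_ge hst)
    nlinarith
  have h1 : √(exp (-t)) = √(exp (-s)) * exp ((s - t) / 2) := by
    rw [← Real.exp_half, ← Real.exp_half, ← Real.exp_add]
    congr 1
    ring
  have h2 := Real.add_one_le_exp ((s - t) / 2)
  have h3 : exp ((s - t) / 2) ≤ 1 := Real.exp_le_one_iff.2 (by linarith)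
  have h4 : (1 - exp ((s - t) / 2)) ^ 2 ≤ ((t - s) / 2) ^ 2 :=
    pow_le_pow_left₀ (by linarith) (by linarith) 2
  calc (√(exp (-s)) - √(exp (-t))) ^ 2
      = exp (-s) * (1 - exp ((s - t) / 2)) ^ 2 := by
        rw [h1, ← mul_one_sub, mul_pow, Real.sq_sqrt (Real.exp_pos _).le]
    _ ≤ E * ((t - s) / 2) ^ 2 := by
        exact mul_le_mul hs h4 (sq_nonneg _) ((Real.exp_pos _).le.trans hs)
    _ = E * (s - t) ^ 2 / 4 := by ring

/-- If `f2` does not vanish on the norms of all points, integrability of `f2² f1` along the norm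
forces integrability of `f1` along the norm. -/
lemma integrable_comp_norm_of_sq_mul {X : Type*} [NormedAddCommGroup X] [MeasurableSpace X]
    [BorelSpace X] {μ : Measure X} [IsFiniteMeasure μ] {f1 f2 : ℝ → ℝ}
    (hf1_mono : MonotoneOn f1 (Set.Ici 0)) (hf1_nonneg : ∀ t : ℝ, 0 ≤ t → 0 ≤ f1 t)
    (hf2_mono : MonotoneOn f2 (Set.Ici 0)) (hf2_nonneg : ∀ t : ℝ, 0 ≤ t → 0 ≤ f2 t)
    (hint : Integrable (fun u : X => (f2 ‖u‖) ^ 2 * f1 ‖u‖) μ) {t : ℝ} (ht : 0 ≤ t)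
    (hft : f2 t ≠ 0) : Integrable (fun u : X => f1 ‖u‖) μ := by
  have hpos : 0 < f2 t := lt_of_le_of_ne (hf2_nonneg t ht) hft.symm
  have hmeas : Measurable (fun u : X => f1 ‖u‖) := by
    have hmono : Monotone (fun s : ℝ => f1 (max s 0)) := fun a b hab =>
      hf1_mono (le_max_right a 0) (le_max_right b 0) (max_le_max_right 0 hab)
    simpa [Function.comp_def] using hmono.measurable.comp (measurable_norm (α := X))
  refine ((integrable_const (f1 t)).add (hint.div_const (f2 t ^ 2))).mono'
    hmeas.aestronglyMeasurable (ae_of_all _ fun u => ?_)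
  have hu := hf1_nonneg ‖u‖ (norm_nonneg u)
  rw [Real.norm_of_nonneg hu, Pi.add_apply]
  rcases le_total ‖u‖ t with h | h
  · have := hf1_mono (norm_nonneg u) ht h
    have : 0 ≤ f2 ‖u‖ ^ 2 * f1 ‖u‖ / f2 t ^ 2 := by positivity
    linarith
  · have h2 := pow_le_pow_left₀ hpos.le (hf2_mono ht (norm_nonneg u) h) 2
    have : f1 ‖u‖ ≤ f2 ‖u‖ ^ 2 * f1 ‖u‖ / f2 t ^ 2 := by
      rw [le_div_iff₀ (by positivity), mul_comm]
      exact mul_le_mul_of_nonneg_right h2 hu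
    linarith [hf1_nonneg t ht]

lemma exists_measureReal_ball_pos {X : Type*} [NormedAddCommGroup X] [MeasurableSpace X]
    (μ : Measure X) [IsProbabilityMeasure μ] (r : ℝ) :
    ∃ R, r ≤ R ∧ 0 < μ.real (Metric.ball 0 R) := by
  obtain ⟨n, hn⟩ : ∃ n : ℕ, 0 < μ (Metric.ball (0 : X) n) := by
    apply exists_measure_pos_of_not_measure_iUnion_null
    rw [Metric.iUnion_ball_nat]
    simp
  refine ⟨max r n, le_max_left _ _, ?_⟩
  exact ENNReal.toReal_pos
    (hn.trans_le (measure_mono (Metric.ball_subset_ball (le_max_right _ _)))).ne'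
    (measure_ne_top _ _)

/-- Local Lipschitz stability of the posterior in the Hellinger
distance (computed with `ν = μ0`): under Assumptions (i), (ii), (iv) and
integrability of `f2(‖u‖)² f1(‖u‖)` w.r.t. the prior, for every `r > 0` there is
`C'(r) > 0` with `d_H(μ^y, μ^{y'}) ≤ C'(r) ‖y - y'‖` for all `y, y' ∈ B_Y(r)`. -/
theorem posterior_stability_Hellinger
    {X Y : Type*} [NormedAddCommGroup X] [NormedSpace ℝ X] [CompleteSpace X]
    [MeasurableSpace X] [BorelSpace X]
    [NormedAddCommGroup Y] [NormedSpace ℝ Y] [CompleteSpace Y]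
    (μ0 : Measure X) [IsProbabilityMeasure μ0]
    (Φ : X → Y → ℝ)
    (hmeas : ∀ y : Y, Measurable (fun u => Φ u y))
    (f1 f2 : ℝ → ℝ)
    (hf1_mono : MonotoneOn f1 (Set.Ici 0))
    (hf1_ge : ∀ t : ℝ, 0 ≤ t → 1 ≤ f1 t)
    (hf2_mono : MonotoneOn f2 (Set.Ici 0))
    (hf2_nonneg : ∀ t : ℝ, 0 ≤ t → 0 ≤ f2 t)
    (hi : ∀ r > 0, ∃ M : ℝ, ∀ u : X, ∀ y : Y, ‖y‖ < r →
      M - Real.log (f1 ‖u‖) ≤ Φ u y)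
    (hii : ∀ r > 0, ∃ K > 0, ∀ u : X, ∀ y : Y, ‖u‖ < r → ‖y‖ < r → Φ u y ≤ K)
    (hiv : ∀ r > 0, ∃ C > 0, ∀ u : X, ∀ y1 y2 : Y, ‖y1‖ < r → ‖y2‖ < r →
      |Φ u y1 - Φ u y2| ≤ C * f2 ‖u‖ * ‖y1 - y2‖)
    (hint : Integrable (fun u => (f2 ‖u‖) ^ 2 * f1 ‖u‖) μ0) :
    ∀ r > 0, ∃ C' > 0, ∀ y y' : Y, ‖y‖ < r → ‖y'‖ < r →
      Real.sqrt ((1 / 2) * ∫ u,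
          (Real.sqrt (Real.exp (-(Φ u y)) / (∫ v, Real.exp (-(Φ v y)) ∂μ0)) -
            Real.sqrt (Real.exp (-(Φ u y')) / (∫ v, Real.exp (-(Φ v y')) ∂μ0))) ^ 2 ∂μ0)
        ≤ C' * ‖y - y'‖ := by
  intro r hr
  by_cases hf2 : ∀ u : X, f2 ‖u‖ = 0
  · refine ⟨1, one_pos, fun y y' hy hy' => ?_⟩
    obtain ⟨C, -, hC⟩ := hiv r hr
    have hΦ : ∀ u, Φ u y = Φ u y' := fun u => by
      have := hC u y y' hy hy'
      rw [hf2 u, mul_zero, zero_mul] at this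
      exact sub_eq_zero.1 (abs_nonpos_iff.1 this)
    simp [hΦ]
  push Not at hf2
  obtain ⟨u₀, hu₀⟩ := hf2
  have hf1_nonneg : ∀ t : ℝ, 0 ≤ t → 0 ≤ f1 t := fun t ht => zero_le_one.trans (hf1_ge t ht)
  have hf1_int := integrable_comp_norm_of_sq_mul hf1_mono hf1_nonneg hf2_mono hf2_nonneg hint
    (norm_nonneg u₀) hu₀
  obtain ⟨M, hM⟩ := hi r hr
  obtain ⟨C, hC0, hC⟩ := hiv r hr
  obtain ⟨R, hrR, hR⟩ := exists_measureReal_ball_pos μ0 r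
  obtain ⟨K, -, hK⟩ := hii R (hr.trans_le hrR)
  have hexp_le : ∀ y : Y, ‖y‖ < r → ∀ u, exp (-(Φ u y)) ≤ exp (-M) * f1 ‖u‖ := by
    intro y hy u
    rw [← Real.exp_log (zero_lt_one.trans_le (hf1_ge ‖u‖ (norm_nonneg u))), ← Real.exp_add]
    exact Real.exp_le_exp.2 (by linarith [hM u y hy])
  have hexp_int : ∀ y : Y, ‖y‖ < r → Integrable (fun u => exp (-(Φ u y))) μ0 := by
    intro y hy
    refine (hf1_int.const_mul (exp (-M))).mono'
      (hmeas y).neg.exp.aestronglyMeasurable (ae_of_all _ fun u => ?_)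
    rw [Real.norm_of_nonneg (Real.exp_pos _).le]
    exact hexp_le y hy u
  set c := exp (-K) * μ0.real (Metric.ball 0 R)
  have hc : 0 < c := mul_pos (Real.exp_pos _) hR
  have hZ : ∀ y : Y, ‖y‖ < r → c ≤ ∫ u, exp (-(Φ u y)) ∂μ0 := by
    intro y hy
    calc c ≤ ∫ u in Metric.ball 0 R, exp (-(Φ u y)) ∂μ0 := by
          refine setIntegral_ge_of_const_le_real measurableSet_ball (measure_ne_top _ _)
            (fun u hu => Real.exp_le_exp.2 (neg_le_neg ?_)) (hexp_int y hy).integrableOn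
          exact hK u y (mem_ball_zero_iff.1 hu) (hy.trans_le hrR)
      _ ≤ _ := setIntegral_le_integral (hexp_int y hy)
          (ae_of_all _ fun u => (Real.exp_pos _).le)
  set I := ∫ u, (f2 ‖u‖) ^ 2 * f1 ‖u‖ ∂μ0
  have hI : 0 ≤ I := integral_nonneg fun u =>
    mul_nonneg (sq_nonneg _) (hf1_nonneg _ (norm_nonneg u))
  set A := exp (-M) * C ^ 2 / 4 * I / c
  have hA : 0 ≤ A := by positivity
  refine ⟨√A + 1, by positivity, fun y y' hy hy' => ?_⟩
  have hZy := hZ y hy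
  have hZy' := hZ y' hy'
  have hdiff : ∫ u, (√(exp (-(Φ u y))) - √(exp (-(Φ u y')))) ^ 2 ∂μ0 ≤
      exp (-M) * C ^ 2 / 4 * ‖y - y'‖ ^ 2 * I := by
    rw [← integral_const_mul]
    refine integral_mono_of_nonneg (ae_of_all _ fun u => sq_nonneg _) (hint.const_mul _)
      (ae_of_all _ fun u => ?_)
    have h1 := sq_sub_sqrt_exp_neg_le (hexp_le y hy u) (hexp_le y' hy' u)
    have h2 : (Φ u y - Φ u y') ^ 2 ≤ (C * f2 ‖u‖ * ‖y - y'‖) ^ 2 := by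
      rw [← sq_abs]
      exact pow_le_pow_left₀ (abs_nonneg _) (hC u y y' hy hy') 2
    have h3 := mul_le_mul_of_nonneg_left h2
      (mul_nonneg (Real.exp_pos (-M)).le (hf1_nonneg _ (norm_nonneg u)))
    dsimp only
    linarith
  have hsqrt : c ≤ √(∫ u, exp (-(Φ u y)) ∂μ0) * √(∫ u, exp (-(Φ u y')) ∂μ0) := by
    calc c = √c * √c := (Real.mul_self_sqrt hc.le).symm
      _ ≤ _ := by gcongr
  have hmain := integral_sq_sub_sqrt_div_integral_le (fun u => (Real.exp_pos (-(Φ u y))).le)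
    (fun u => (Real.exp_pos (-(Φ u y'))).le) (hexp_int y hy) (hexp_int y' hy')
    (hc.trans_le hZy) (hc.trans_le hZy')
  have hbound := hmain.trans (div_le_div₀ (by positivity) hdiff hc hsqrt)
  have hA_eq : exp (-M) * C ^ 2 / 4 * ‖y - y'‖ ^ 2 * I / c = A * ‖y - y'‖ ^ 2 := by
    simp only [A]
    ring
  rw [hA_eq] at hbound
  refine Real.sqrt_le_iff.2 ⟨by positivity, ?_⟩
  have h1 : A ≤ (√A + 1) ^ 2 := by
    nlinarith [Real.sq_sqrt hA, Real.sqrt_nonneg A]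
  have h2 := mul_le_mul_of_nonneg_right h1 (sq_nonneg ‖y - y'‖)
  have h3 : 0 ≤ A * ‖y - y'‖ ^ 2 := by positivity
  rw [mul_pow]
  linarith
end

section
/- Let X and Y be Banach spaces and μ0 a Borel probability measure on X such that ∫_X exp(b‖u‖_X) dμ0(u) < ∞ for some constant b > 0. Let Φ : X × Y → ℝ satisfy conditions (i)–(iv) of the likelihood assumptions with nondecreasing functions f1 : [0,∞) → [1,∞) and f2 : [0,∞) → [0,∞) that are polynomially bounded, i.e. there exist constants c > 0 and s > 0 with f1(t) ≤ c(1 + t^s) and f2(t) ≤ c(1 + t^s) for all t ≥ 0. Then for every y ∈ Y the posterior μ^y with dμ^y/dμ0 = exp(−Φ(·;y))/Z(y), Z(y) = ∫_X exp(−Φ(u;y)) dμ0(u), is a well-defined probability measure, and for every r > 0 there exists C(r) > 0 such that d_TV(μ^y, μ^{y'}) ≤ C(r)‖y − y'‖_Y and d_H(μ^y, μ^{y'}) ≤ C(r)‖y − y'‖_Y for all y, y' ∈ B_Y(r). -/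
open MeasureTheory Real

/-- Local Lipschitz bound for `exp (-·)`. -/
lemma abs_exp_neg_sub_exp_neg_le {a a' S : ℝ} (ha : exp (-a) ≤ S) (ha' : exp (-a') ≤ S) :
    |exp (-a) - exp (-a')| ≤ S * |a - a'| := by
  wlog h : a ≤ a' generalizing a a'
  · rw [abs_sub_comm, abs_sub_comm a]
    exact this ha' ha (le_of_not_ge h)
  have h1 : exp (-a') ≤ exp (-a) := exp_le_exp.mpr (by linarith)
  rw [abs_of_nonneg (by linarith), abs_of_nonpos (by linarith)]
  have h2 : exp (-a') = exp (-a) * exp (a - a') := by rw [← exp_add]; ring_nf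
  have h3 : a - a' + 1 ≤ exp (a - a') := add_one_le_exp _
  have h4 : exp (-a) * (1 - exp (a - a')) ≤ exp (-a) * (a' - a) :=
    mul_le_mul_of_nonneg_left (by linarith) (exp_pos _).le
  have h5 : exp (-a) * (a' - a) ≤ S * (a' - a) :=
    mul_le_mul_of_nonneg_right ha (by linarith)
  rw [h2]
  linarith

lemma sq_sqrt_exp_neg_sub_le {a a' S : ℝ} (ha : exp (-a) ≤ S) (ha' : exp (-a') ≤ S) :
    (√(exp (-a)) - √(exp (-a'))) ^ 2 ≤ S * (a - a') ^ 2 := by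
  have hS : 0 ≤ S := (exp_pos _).le.trans ha
  have hs : √(exp (-a)) = exp (-(a / 2)) := by rw [← exp_half, neg_div]
  have hs' : √(exp (-a')) = exp (-(a' / 2)) := by rw [← exp_half, neg_div]
  have h := abs_exp_neg_sub_exp_neg_le (S := √S) (hs ▸ sqrt_le_sqrt ha) (hs' ▸ sqrt_le_sqrt ha')
  rw [← hs, ← hs'] at h
  have h2 := pow_le_pow_left₀ (abs_nonneg _) h 2
  rw [sq_abs, mul_pow, sq_abs, sq_sqrt hS] at h2
  refine h2.trans (mul_le_mul_of_nonneg_left ?_ hS)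
  nlinarith [sq_nonneg (a - a')]

/-- A polynomially bounded function is dominated by every exponential. -/
lemma exists_polynomial_le_mul_exp {c a : ℝ} (hc : 0 < c) (ha : 0 < a) (s : ℕ) :
    ∃ D > 0, ∀ t : ℝ, 0 ≤ t → c * (1 + t ^ s) ≤ D * exp (a * t) := by
  refine ⟨c * (1 + s.factorial / a ^ s), by positivity, fun t ht => ?_⟩
  have h1 : (a * t) ^ s / s.factorial ≤ exp (a * t) :=
    pow_div_factorial_le_exp _ (by positivity) s
  have h2 : t ^ s ≤ s.factorial / a ^ s * exp (a * t) := by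
    have h3 : t ^ s = s.factorial / a ^ s * ((a * t) ^ s / s.factorial) := by
      rw [mul_pow]
      field_simp
    rw [h3]
    exact mul_le_mul_of_nonneg_left h1 (by positivity)
  have h4 : 1 ≤ exp (a * t) := one_le_exp (by positivity)
  rw [mul_assoc, add_mul, one_mul]
  exact mul_le_mul_of_nonneg_left (add_le_add h4 h2) hc.le

lemma abs_log_sub_log_le {z x x' : ℝ} (hz : 0 < z) (hx : z ≤ x) (hx' : z ≤ x') :
    |log x - log x'| ≤ |x - x'| / z := by
  wlog h : x' ≤ x generalizing x x'
  · rw [abs_sub_comm, abs_sub_comm x]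
    exact this hx' hx (le_of_not_ge h)
  have hx0 : 0 < x := hz.trans_le hx
  have hx0' : 0 < x' := hz.trans_le hx'
  rw [abs_of_nonneg (sub_nonneg.mpr (log_le_log hx0' h)), abs_of_nonneg (sub_nonneg.mpr h),
    ← log_div hx0.ne' hx0'.ne']
  refine (log_le_sub_one_of_pos (by positivity)).trans ?_
  rw [div_sub_one hx0'.ne']
  exact div_le_div_of_nonneg_left (sub_nonneg.mpr h) hz hx'

/-- Normalised Gibbs densities are stable under perturbation of the potential, in the
total variation and Hellinger distances, relative to a weight `w ≥ 1` with finite third moment. -/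
lemma gibbs_density_stability {X : Type*} [MeasurableSpace X] {μ : Measure X}
    {w φ φ' : X → ℝ} {A C z δ : ℝ} (hw : ∀ u, 1 ≤ w u) (hwi : Integrable (fun u => w u ^ 3) μ)
    (hA0 : 0 ≤ A) (hC : 0 ≤ C) (hz : 0 < z) (hδ : 0 ≤ δ)
    (hφ : Integrable (fun u => exp (-φ u)) μ) (hφ' : Integrable (fun u => exp (-φ' u)) μ)
    (hA : ∀ u, exp (-φ u) ≤ A * w u) (hA' : ∀ u, exp (-φ' u) ≤ A * w u)
    (hd : ∀ u, |φ u - φ' u| ≤ C * w u * δ)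
    (hZ : z ≤ ∫ u, exp (-φ u) ∂μ) (hZ' : z ≤ ∫ u, exp (-φ' u) ∂μ) :
    ∫ u, |exp (-φ u) / (∫ v, exp (-φ v) ∂μ) - exp (-φ' u) / (∫ v, exp (-φ' v) ∂μ)| ∂μ
      ≤ A / z * (∫ u, w u ^ 3 ∂μ) * (C + A * C * (∫ u, w u ^ 3 ∂μ) / z) * δ ∧
    ∫ u, (√(exp (-φ u) / (∫ v, exp (-φ v) ∂μ)) - √(exp (-φ' u) / (∫ v, exp (-φ' v) ∂μ))) ^ 2 ∂μ
      ≤ A / z * (∫ u, w u ^ 3 ∂μ) * ((C + A * C * (∫ u, w u ^ 3 ∂μ) / z) * δ) ^ 2 := by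
  set Z := ∫ v, exp (-φ v) ∂μ
  set Z' := ∫ v, exp (-φ' v) ∂μ
  set J := ∫ u, w u ^ 3 ∂μ
  have hw0 : ∀ u, 0 ≤ w u := fun u => zero_le_one.trans (hw u)
  have hw23 : ∀ u, w u ^ 2 ≤ w u ^ 3 := fun u => pow_le_pow_right₀ (hw u) (by norm_num)
  have hJ : 0 ≤ J := integral_nonneg fun u => pow_nonneg (hw0 u) 3
  have hZ0 : 0 < Z := hz.trans_le hZ
  have hZ0' : 0 < Z' := hz.trans_le hZ'
  have hZd : |Z - Z'| ≤ A * C * J * δ := by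
    have h : ‖∫ u, (exp (-φ u) - exp (-φ' u)) ∂μ‖ ≤ ∫ u, A * C * δ * w u ^ 3 ∂μ := by
      refine norm_integral_le_of_norm_le (hwi.const_mul _) (Filter.Eventually.of_forall fun u => ?_)
      rw [norm_eq_abs]
      calc |exp (-φ u) - exp (-φ' u)| ≤ A * w u * |φ u - φ' u| :=
            abs_exp_neg_sub_exp_neg_le (hA u) (hA' u)
        _ ≤ A * w u * (C * w u * δ) :=
            mul_le_mul_of_nonneg_left (hd u) (mul_nonneg hA0 (hw0 u))
        _ = A * C * δ * w u ^ 2 := by ring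
        _ ≤ A * C * δ * w u ^ 3 := mul_le_mul_of_nonneg_left (hw23 u) (by positivity)
    rw [integral_sub hφ hφ', integral_const_mul, norm_eq_abs] at h
    linarith
  set B := C + A * C * J / z with hB
  have hB0 : 0 ≤ B := by positivity
  have hdiff : ∀ u, |(φ u + log Z) - (φ' u + log Z')| ≤ B * w u * δ := fun u => by
    have h1 : |log Z - log Z'| ≤ A * C * J / z * δ :=
      (abs_log_sub_log_le hz hZ hZ').trans
        ((div_le_div_of_nonneg_right hZd hz.le).trans_eq (by ring))
    have h2 : A * C * J / z * δ ≤ A * C * J / z * δ * w u :=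
      le_mul_of_one_le_right (by positivity) (hw u)
    calc |(φ u + log Z) - (φ' u + log Z')| = |(φ u - φ' u) + (log Z - log Z')| := by ring_nf
      _ ≤ |φ u - φ' u| + |log Z - log Z'| := abs_add_le _ _
      _ ≤ C * w u * δ + A * C * J / z * δ * w u := add_le_add (hd u) (h1.trans h2)
      _ = B * w u * δ := by rw [hB]; ring
  have hexp : ∀ {x ζ : ℝ}, 0 < ζ → exp (-x) / ζ = exp (-(x + log ζ)) := fun hζ => by
    rw [neg_add, exp_add, exp_neg (log _), exp_log hζ, div_eq_mul_inv]
  have hup : ∀ {x ζ : ℝ} {u : X}, exp (-x) ≤ A * w u → 0 < ζ → z ≤ ζ →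
      exp (-(x + log ζ)) ≤ A / z * w u := fun {x ζ u} hx hζ hzζ => by
    rw [← hexp hζ]
    exact (div_le_div₀ ((exp_pos _).le.trans hx) hx hz hzζ).trans_eq (by ring)
  have hS : ∀ u, 0 ≤ A / z * w u := fun u => mul_nonneg (by positivity) (hw0 u)
  simp only [hexp hZ0, hexp hZ0']
  constructor
  · have h : ∫ u, |exp (-(φ u + log Z)) - exp (-(φ' u + log Z'))| ∂μ
        ≤ ∫ u, A / z * B * δ * w u ^ 3 ∂μ := by
      refine integral_mono_of_nonneg (Filter.Eventually.of_forall fun u => abs_nonneg _)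
        (hwi.const_mul _) (Filter.Eventually.of_forall fun u => ?_)
      calc |exp (-(φ u + log Z)) - exp (-(φ' u + log Z'))|
          ≤ A / z * w u * |(φ u + log Z) - (φ' u + log Z')| :=
            abs_exp_neg_sub_exp_neg_le (hup (hA u) hZ0 hZ) (hup (hA' u) hZ0' hZ')
        _ ≤ A / z * w u * (B * w u * δ) := mul_le_mul_of_nonneg_left (hdiff u) (hS u)
        _ = A / z * B * δ * w u ^ 2 := by ring
        _ ≤ A / z * B * δ * w u ^ 3 := mul_le_mul_of_nonneg_left (hw23 u) (by positivity)
    rw [integral_const_mul] at h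
    exact h.trans_eq (by ring)
  · have h : ∫ u, (√(exp (-(φ u + log Z))) - √(exp (-(φ' u + log Z')))) ^ 2 ∂μ
        ≤ ∫ u, A / z * (B * δ) ^ 2 * w u ^ 3 ∂μ := by
      refine integral_mono_of_nonneg (Filter.Eventually.of_forall fun u => sq_nonneg _)
        (hwi.const_mul _) (Filter.Eventually.of_forall fun u => ?_)
      calc (√(exp (-(φ u + log Z))) - √(exp (-(φ' u + log Z')))) ^ 2
          ≤ A / z * w u * ((φ u + log Z) - (φ' u + log Z')) ^ 2 :=
            sq_sqrt_exp_neg_sub_le (hup (hA u) hZ0 hZ) (hup (hA' u) hZ0' hZ')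
        _ = A / z * w u * |(φ u + log Z) - (φ' u + log Z')| ^ 2 := by rw [sq_abs]
        _ ≤ A / z * w u * (B * w u * δ) ^ 2 :=
            mul_le_mul_of_nonneg_left (pow_le_pow_left₀ (abs_nonneg _) (hdiff u) 2) (hS u)
        _ = A / z * (B * δ) ^ 2 * w u ^ 3 := by ring
    rw [integral_const_mul] at h
    exact h.trans_eq (by ring)

lemma continuous_of_lipschitz_on_balls {X : Type*} [NormedAddCommGroup X] {g : X → ℝ}
    (h : ∀ r > 0, ∃ L : ℝ, ∀ u v : X, ‖u‖ < r → ‖v‖ < r → |g u - g v| ≤ L * ‖u - v‖) :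
    Continuous g := by
  refine continuous_iff_continuousAt.mpr fun u => ?_
  obtain ⟨L, hL⟩ := h (‖u‖ + 1) (by positivity)
  refine continuousAt_of_locally_lipschitz one_pos L fun v hv => ?_
  rw [dist_eq_norm] at hv
  rw [dist_eq_norm, dist_eq_norm, norm_eq_abs]
  refine hL v u ?_ (by linarith)
  linarith [norm_sub_norm_le v u]

lemma exists_ball_measureReal_pos {X : Type*} [NormedAddCommGroup X] [MeasurableSpace X]
    (μ : Measure X) [IsProbabilityMeasure μ] (r : ℝ) :
    ∃ R ≥ r, 0 < μ.real (Metric.ball (0 : X) R) := by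
  obtain ⟨n, hn⟩ : ∃ n : ℕ, 0 < μ (Metric.ball (0 : X) n) := by
    by_contra! h
    have h0 : μ (⋃ n : ℕ, Metric.ball (0 : X) n) = 0 :=
      measure_iUnion_null fun n => le_antisymm (h n) bot_le
    rw [Metric.iUnion_ball_nat, measure_univ] at h0
    exact one_ne_zero h0
  refine ⟨max r n, le_max_left _ _, ENNReal.toReal_pos ?_ (measure_ne_top _ _)⟩
  exact (hn.trans_le (measure_mono (Metric.ball_subset_ball (le_max_right _ _)))).ne'

/-- Well-posedness for priors with exponential tails: if the prior
has a finite exponential moment and `Φ` satisfies Assumptions (i)-(iv) with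
polynomially bounded functions `f1, f2`, then the posterior is well-defined and
locally Lipschitz in the data in both the total variation and Hellinger
distances (computed with `ν = μ0`). -/
theorem well_posedness_exponential_tails
    {X Y : Type*} [NormedAddCommGroup X] [NormedSpace ℝ X] [CompleteSpace X]
    [MeasurableSpace X] [BorelSpace X]
    [NormedAddCommGroup Y] [NormedSpace ℝ Y] [CompleteSpace Y]
    (μ0 : Measure X) [IsProbabilityMeasure μ0]
    (b : ℝ) (hb : 0 < b)
    (hexp : Integrable (fun u => Real.exp (b * ‖u‖)) μ0)
    (Φ : X → Y → ℝ) (f1 f2 : ℝ → ℝ)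
    (hf1_mono : MonotoneOn f1 (Set.Ici 0))
    (hf1_ge : ∀ t : ℝ, 0 ≤ t → 1 ≤ f1 t)
    (hf2_mono : MonotoneOn f2 (Set.Ici 0))
    (hf2_nonneg : ∀ t : ℝ, 0 ≤ t → 0 ≤ f2 t)
    (hpoly : ∃ c > 0, ∃ s > 0, ∀ t : ℝ, 0 ≤ t →
      f1 t ≤ c * (1 + t ^ s) ∧ f2 t ≤ c * (1 + t ^ s))
    (hi : ∀ r > 0, ∃ M : ℝ, ∀ u : X, ∀ y : Y, ‖y‖ < r →
      M - Real.log (f1 ‖u‖) ≤ Φ u y)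
    (hii : ∀ r > 0, ∃ K > 0, ∀ u : X, ∀ y : Y, ‖u‖ < r → ‖y‖ < r → Φ u y ≤ K)
    (hiii : ∀ r > 0, ∃ L > 0, ∀ u1 u2 : X, ∀ y : Y,
      ‖u1‖ < r → ‖u2‖ < r → ‖y‖ < r → |Φ u1 y - Φ u2 y| ≤ L * ‖u1 - u2‖)
    (hiv : ∀ r > 0, ∃ C > 0, ∀ u : X, ∀ y1 y2 : Y, ‖y1‖ < r → ‖y2‖ < r →
      |Φ u y1 - Φ u y2| ≤ C * f2 ‖u‖ * ‖y1 - y2‖) :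
    (∀ y : Y,
      Integrable (fun u => Real.exp (-(Φ u y))) μ0 ∧
      0 < ∫ u, Real.exp (-(Φ u y)) ∂μ0 ∧
      IsProbabilityMeasure
        (μ0.withDensity (fun u =>
          ENNReal.ofReal (Real.exp (-(Φ u y)) / ∫ v, Real.exp (-(Φ v y)) ∂μ0)))) ∧
    (∀ r > 0, ∃ C' > 0, ∀ y y' : Y, ‖y‖ < r → ‖y'‖ < r →
      ((1 / 2) * ∫ u,
          |Real.exp (-(Φ u y)) / (∫ v, Real.exp (-(Φ v y)) ∂μ0) -
            Real.exp (-(Φ u y')) / (∫ v, Real.exp (-(Φ v y')) ∂μ0)| ∂μ0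
        ≤ C' * ‖y - y'‖) ∧
      (Real.sqrt ((1 / 2) * ∫ u,
          (Real.sqrt (Real.exp (-(Φ u y)) / (∫ v, Real.exp (-(Φ v y)) ∂μ0)) -
            Real.sqrt (Real.exp (-(Φ u y')) / (∫ v, Real.exp (-(Φ v y')) ∂μ0))) ^ 2 ∂μ0)
        ≤ C' * ‖y - y'‖)) := by
  obtain ⟨c, hc, s, -, hcs⟩ := hpoly
  obtain ⟨D, hD, hDt⟩ := exists_polynomial_le_mul_exp hc (show 0 < b / 3 by positivity) s
  set w : X → ℝ := fun u => exp (b / 3 * ‖u‖) with hw_def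
  have hw : ∀ u, 1 ≤ w u := fun u => one_le_exp (by positivity)
  have hw0 : ∀ u, 0 ≤ w u := fun u => zero_le_one.trans (hw u)
  have hwi : Integrable (fun u => w u ^ 3) μ0 := by
    refine hexp.congr (Filter.Eventually.of_forall fun u => ?_)
    simp only [hw_def]
    rw [← exp_nat_mul]
    push_cast
    ring_nf
  have hf1 : ∀ u : X, f1 ‖u‖ ≤ D * w u := fun u =>
    (hcs _ (norm_nonneg u)).1.trans (hDt _ (norm_nonneg u))
  have hf2 : ∀ u : X, f2 ‖u‖ ≤ D * w u := fun u =>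
    (hcs _ (norm_nonneg u)).2.trans (hDt _ (norm_nonneg u))
  have hupper : ∀ r > 0, ∃ A > 0, ∀ u : X, ∀ y : Y, ‖y‖ < r → exp (-(Φ u y)) ≤ A * w u := by
    intro r hr
    obtain ⟨M, hM⟩ := hi r hr
    refine ⟨exp (-M) * D, by positivity, fun u y hy => ?_⟩
    have hpos : 0 < f1 ‖u‖ := one_pos.trans_le (hf1_ge _ (norm_nonneg u))
    calc exp (-(Φ u y)) ≤ exp (-M + log (f1 ‖u‖)) := exp_le_exp.mpr (by linarith [hM u y hy])
      _ = exp (-M) * f1 ‖u‖ := by rw [exp_add, exp_log hpos]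
      _ ≤ exp (-M) * (D * w u) := mul_le_mul_of_nonneg_left (hf1 u) (exp_pos _).le
      _ = exp (-M) * D * w u := by ring
  have hmeas : ∀ y : Y, Measurable fun u => exp (-(Φ u y)) := fun y => by
    refine (continuous_exp.comp (continuous_of_lipschitz_on_balls (g := fun u => Φ u y)
      fun r hr => ?_).neg).measurable
    obtain ⟨L, -, hL⟩ := hiii (max r (‖y‖ + 1)) (lt_max_of_lt_left hr)
    exact ⟨L, fun u v hu hv => hL u v y (lt_max_of_lt_left hu) (lt_max_of_lt_left hv)
      (lt_max_of_lt_right (lt_add_one _))⟩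
  have hint : ∀ y : Y, Integrable (fun u => exp (-(Φ u y))) μ0 := fun y => by
    obtain ⟨A, hA, hAu⟩ := hupper (‖y‖ + 1) (by positivity)
    refine (hwi.const_mul A).mono' (hmeas y).aestronglyMeasurable
      (Filter.Eventually.of_forall fun u => ?_)
    rw [norm_eq_abs, abs_of_pos (exp_pos _)]
    exact (hAu u y (lt_add_one _)).trans
      (mul_le_mul_of_nonneg_left (le_self_pow₀ (hw u) (by norm_num)) hA.le)
  have hlower : ∀ r > 0, ∃ z > 0, ∀ y : Y, ‖y‖ < r → z ≤ ∫ u, exp (-(Φ u y)) ∂μ0 := by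
    intro r hr
    obtain ⟨R, hrR, hR⟩ := exists_ball_measureReal_pos μ0 r
    obtain ⟨K, -, hK⟩ := hii R (hr.trans_le hrR)
    refine ⟨exp (-K) * μ0.real (Metric.ball 0 R), by positivity, fun y hy => ?_⟩
    calc exp (-K) * μ0.real (Metric.ball 0 R)
        ≤ ∫ u in Metric.ball 0 R, exp (-(Φ u y)) ∂μ0 :=
          setIntegral_ge_of_const_le_real measurableSet_ball (measure_ne_top _ _)
            (fun u hu => exp_le_exp.mpr (neg_le_neg
              (hK u y (mem_ball_zero_iff.mp hu) (hy.trans_le hrR)))) (hint y).integrableOn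
      _ ≤ ∫ u, exp (-(Φ u y)) ∂μ0 :=
          setIntegral_le_integral (hint y) (Filter.Eventually.of_forall fun u => (exp_pos _).le)
  have hpos : ∀ y : Y, 0 < ∫ u, exp (-(Φ u y)) ∂μ0 := fun y => by
    obtain ⟨z, hz, hzy⟩ := hlower (‖y‖ + 1) (by positivity)
    exact hz.trans_le (hzy y (lt_add_one _))
  refine ⟨fun y => ⟨hint y, hpos y, ⟨?_⟩⟩, fun r hr => ?_⟩
  · rw [withDensity_apply _ MeasurableSet.univ, Measure.restrict_univ,
      ← ofReal_integral_eq_lintegral_ofReal ((hint y).div_const _)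
        (Filter.Eventually.of_forall fun u => div_nonneg (exp_pos _).le (hpos y).le),
      integral_div, div_self (hpos y).ne', ENNReal.ofReal_one]
  · obtain ⟨A, hA, hAu⟩ := hupper r hr
    obtain ⟨z, hz, hzy⟩ := hlower r hr
    obtain ⟨C, hC, hCu⟩ := hiv r hr
    set J := ∫ u, w u ^ 3 ∂μ0
    have hJ : 0 ≤ J := integral_nonneg fun u => pow_nonneg (hw0 u) 3
    set P := A / z * J
    have hP0 : 0 ≤ P := by positivity
    set B := C * D + A * (C * D) * J / z
    have hB : 0 < B := by positivity
    refine ⟨(P + 1) * B, by positivity, fun y y' hy hy' => ?_⟩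
    have hδ : 0 ≤ ‖y - y'‖ := norm_nonneg _
    obtain ⟨htv, hhel⟩ := gibbs_density_stability (φ := fun u => Φ u y) (φ' := fun u => Φ u y')
      hw hwi hA.le (mul_pos hC hD).le hz hδ (hint y) (hint y') (fun u => hAu u y hy)
      (fun u => hAu u y' hy') (fun u => (hCu u y y' hy hy').trans
        (mul_le_mul_of_nonneg_right ((mul_le_mul_of_nonneg_left (hf2 u) hC.le).trans_eq
          (mul_assoc _ _ _).symm) hδ)) (hzy y hy) (hzy y' hy')
    have hBδ : 0 ≤ B * ‖y - y'‖ := mul_nonneg hB.le hδ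
    constructor
    · have h : P * B * ‖y - y'‖ = P * (B * ‖y - y'‖) := by ring
      have h0 : 0 ≤ P * (B * ‖y - y'‖) := mul_nonneg hP0 hBδ
      linarith
    · refine sqrt_le_iff.mpr ⟨by positivity, ?_⟩
      have h0 : 0 ≤ P * (B * ‖y - y'‖) ^ 2 := mul_nonneg hP0 (sq_nonneg _)
      have h1 : P * (B * ‖y - y'‖) ^ 2 ≤ (P + 1) ^ 2 * (B * ‖y - y'‖) ^ 2 :=
        mul_le_mul_of_nonneg_right (by nlinarith) (sq_nonneg _)
      rw [mul_assoc, mul_pow]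
      linarith
end
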